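/- Assume additionally closure(S) ≠ Y. Then Θ ∈ (0, 1), and for every ȳ ∈ Y with ‖ȳ‖ = 1 and inf_{α ∈ D} ‖F(α) − ȳ‖² = Θ the following hold: (i) the set of best approximations P(ȳ) contains at least two distinct elements; (ii) P(ȳ) is contained in the affine subspace H := (1 − Θ)·ȳ + ȳ^⊥, where ȳ^⊥ := {z ∈ Y : ⟨ȳ, z⟩ = 0}; (iii) the vector (1 − Θ)·ȳ lies in the convex hull of P(ȳ). -/

import Mathlib

open Filter Metric
open scoped InnerProductSpace

noncomputable section

/-- The optimal value of the squared loss `inf_{α ∈ D} ‖F α - y‖²`. -/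
def lossInf {Y : Type} [NormedAddCommGroup Y] {m : ℕ}
    (D : Set (Fin m → ℝ)) (F : (Fin m → ℝ) → Y) (y : Y) : ℝ :=
  sInf ((fun α => ‖F α - y‖ ^ 2) '' D)

/-- The worst-case error bound `Θ = sup_{‖y‖ = 1} inf_{α ∈ D} ‖F α - y‖²`. -/
def Theta {Y : Type} [NormedAddCommGroup Y] {m : ℕ}
    (D : Set (Fin m → ℝ)) (F : (Fin m → ℝ) → Y) : ℝ :=
  sSup ((fun y => lossInf D F y) '' {y : Y | ‖y‖ = 1})

/-- The set of best approximations of `y` in `closure (F '' D)`. -/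
def bestApprox {Y : Type} [NormedAddCommGroup Y] {m : ℕ}
    (D : Set (Fin m → ℝ)) (F : (Fin m → ℝ) → Y) (y : Y) : Set Y :=
  {z | z ∈ closure (F '' D) ∧ ‖z - y‖ = Metric.infDist y (closure (F '' D))}

/-- The closure of a set stable under positive scaling is stable under positive scaling. -/
theorem smul_mem_closure_of_cone {Y : Type} [NormedAddCommGroup Y] [NormedSpace ℝ Y] {S : Set Y}
    (hS : ∀ y ∈ S, ∀ s : ℝ, 0 < s → s • y ∈ S) {y : Y} (hy : y ∈ closure S) {s : ℝ}
    (hs : 0 < s) : s • y ∈ closure S :=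
  map_mem_closure (continuous_const_smul s) hy fun x hx => hS x hx s hs

/-- The closure of a nonempty set stable under positive scaling contains the origin. -/
theorem zero_mem_closure_of_cone {Y : Type} [NormedAddCommGroup Y] [NormedSpace ℝ Y] {S : Set Y}
    (hne : S.Nonempty) (hS : ∀ y ∈ S, ∀ s : ℝ, 0 < s → s • y ∈ S) : (0 : Y) ∈ closure S := by
  obtain ⟨y, hy⟩ := hne
  have h : Tendsto (fun n : ℕ => (1 / ((n : ℝ) + 1)) • y) atTop (nhds ((0 : ℝ) • y)) :=
    tendsto_one_div_add_atTop_nhds_zero_nat.smul_const y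
  rw [zero_smul] at h
  exact mem_closure_of_tendsto h (Eventually.of_forall fun n => hS y hy _ (by positivity))

theorem exists_norm_sub_eq_infDist {Y : Type} [NormedAddCommGroup Y] [ProperSpace Y] {C : Set Y}
    (hC : IsClosed C) (hne : C.Nonempty) (y : Y) : ∃ z ∈ C, ‖z - y‖ = infDist y C := by
  obtain ⟨z, hz, h⟩ := hC.exists_infDist_eq_dist hne y
  exact ⟨z, hz, by rw [h, dist_comm, dist_eq_norm]⟩

theorem infDist_le_norm_sub {Y : Type} [NormedAddCommGroup Y] {C : Set Y} {z : Y} (hz : z ∈ C)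
    (y : Y) : infDist y C ≤ ‖z - y‖ := by
  rw [← dist_eq_norm, dist_comm]
  exact infDist_le_dist_of_mem hz

theorem lossInf_eq_infDist_sq {Y : Type} [NormedAddCommGroup Y] [ProperSpace Y] {m : ℕ}
    {D : Set (Fin m → ℝ)} (hD : D.Nonempty) (F : (Fin m → ℝ) → Y) (y : Y) :
    lossInf D F y = infDist y (closure (F '' D)) ^ 2 := by
  apply le_antisymm
  · obtain ⟨z, hz, h⟩ :=
      exists_norm_sub_eq_infDist isClosed_closure (hD.image F).closure y
    rw [← h]
    have hcl : IsClosed {z : Y | lossInf D F y ≤ ‖z - y‖ ^ 2} :=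
      isClosed_le continuous_const (by fun_prop)
    refine closure_minimal ?_ hcl hz
    rintro _ ⟨α, hα, rfl⟩
    exact csInf_le ⟨0, by rintro _ ⟨β, _, rfl⟩; positivity⟩
      (Set.mem_image_of_mem (fun α => ‖F α - y‖ ^ 2) hα)
  · apply le_csInf (hD.image _)
    rintro _ ⟨α, hα, rfl⟩
    exact pow_le_pow_left₀ infDist_nonneg
      (infDist_le_norm_sub (subset_closure (Set.mem_image_of_mem F hα)) y) 2

/-- A best approximation in a cone is orthogonal to its residual. -/
theorem inner_eq_norm_sq_of_norm_sub_eq_infDist {Y : Type} [NormedAddCommGroup Y]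
    [InnerProductSpace ℝ Y] {C : Set Y} (hC : ∀ z ∈ C, ∀ s : ℝ, 0 < s → s • z ∈ C) {y z : Y}
    (hz : z ∈ C) (h : ‖z - y‖ = infDist y C) : ⟪y, z⟫_ℝ = ‖z‖ ^ 2 := by
  have key : ∀ s : ℝ, 0 < s →
      ‖z‖ ^ 2 - 2 * ⟪y, z⟫_ℝ ≤ s ^ 2 * ‖z‖ ^ 2 - 2 * s * ⟪y, z⟫_ℝ := by
    intro s hs
    have h1 : ‖z - y‖ ^ 2 ≤ ‖s • z - y‖ ^ 2 :=
      pow_le_pow_left₀ (norm_nonneg _) (h ▸ infDist_le_norm_sub (hC z hz s hs) y) 2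
    rw [norm_sub_sq_real, norm_sub_sq_real, real_inner_smul_left, norm_smul, mul_pow,
      Real.norm_eq_abs, sq_abs, real_inner_comm] at h1
    linarith
  rcases eq_or_ne z 0 with rfl | hz0
  · simp
  have ha : 0 < ‖z‖ ^ 2 := by positivity
  generalize ‖z‖ ^ 2 = a at *
  generalize ⟪y, z⟫_ℝ = b at *
  rcases le_or_gt b 0 with hb | hb
  · have := key (1 / 2) (by norm_num)
    linarith
  · have h1 := key (b / a) (by positivity)
    have h2 : (b / a) ^ 2 * a - 2 * (b / a) * b = -(b ^ 2 / a) := by field_simp; ring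
    rw [h2] at h1
    have h3 : b ^ 2 / a * a = b ^ 2 := by field_simp
    have h4 : (b - a) ^ 2 ≤ 0 := by nlinarith
    nlinarith [pow_eq_zero_iff (two_ne_zero) |>.1 (le_antisymm h4 (sq_nonneg _))]

theorem infDist_smul_le_of_cone {Y : Type} [NormedAddCommGroup Y] [NormedSpace ℝ Y]
    [ProperSpace Y] {C : Set Y} (hCc : IsClosed C) (hne : C.Nonempty)
    (hC : ∀ z ∈ C, ∀ s : ℝ, 0 < s → s • z ∈ C) (y : Y) {s : ℝ} (hs : 0 < s) :
    infDist (s • y) C ≤ s * infDist y C := by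
  obtain ⟨z, hz, h⟩ := exists_norm_sub_eq_infDist hCc hne y
  rw [← h]
  refine (infDist_le_norm_sub (hC z hz s hs) _).trans_eq ?_
  rw [← smul_sub, norm_smul, Real.norm_of_nonneg hs.le]

/-- If the squared distance to a closed cone is bounded by `θ ‖y‖ ^ 2` with `θ < 1`, with equality
at the unit vector `y`, then no direction orthogonal to `y` has positive inner product with all
best approximations of `y`. -/
theorem exists_bestApprox_inner_nonpos {Y : Type} [NormedAddCommGroup Y]
    [InnerProductSpace ℝ Y] [ProperSpace Y] {C : Set Y} (hCc : IsClosed C) (h0 : (0 : Y) ∈ C)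
    {θ : ℝ} (hθ : θ < 1) (hbound : ∀ y : Y, infDist y C ^ 2 ≤ θ * ‖y‖ ^ 2)
    {y v : Y} (hy : ‖y‖ = 1) (hyθ : infDist y C ^ 2 = θ) (hv : ⟪y, v⟫_ℝ = 0) :
    ∃ z ∈ C, ‖z - y‖ = infDist y C ∧ ⟪v, z⟫_ℝ ≤ 0 := by
  let t : ℕ → ℝ := fun n => 1 / ((n : ℝ) + 1)
  have ht0 : ∀ n, 0 < t n := fun n => by positivity
  have ht : Tendsto t atTop (nhds 0) := tendsto_one_div_add_atTop_nhds_zero_nat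
  have hyt : Tendsto (fun n => y - t n • v) atTop (nhds y) := by
    simpa using (tendsto_const_nhds (x := y)).sub (ht.smul_const v)
  choose z hzC hz using fun n => exists_norm_sub_eq_infDist hCc ⟨0, h0⟩ (y - t n • v)
  have hzneg : ∀ n, ⟪v, z n⟫_ℝ ≤ 0 := by
    intro n
    have hup := hbound (y - t n • v)
    have hlow : θ ≤ ‖z n - y‖ ^ 2 :=
      hyθ ▸ pow_le_pow_left₀ infDist_nonneg (infDist_le_norm_sub (hzC n) y) 2
    have e1 : ‖y - t n • v‖ ^ 2 = 1 + t n ^ 2 * ‖v‖ ^ 2 := by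
      rw [norm_sub_sq_real, real_inner_smul_right, hv, hy, norm_smul, mul_pow,
        Real.norm_eq_abs, sq_abs]
      ring
    have e2 : ‖z n - (y - t n • v)‖ ^ 2
        = ‖z n - y‖ ^ 2 + 2 * (t n * ⟪v, z n⟫_ℝ) + t n ^ 2 * ‖v‖ ^ 2 := by
      rw [show z n - (y - t n • v) = (z n - y) + t n • v by abel, norm_add_sq_real,
        real_inner_smul_right, inner_sub_left, hv, norm_smul, mul_pow,
        Real.norm_eq_abs, sq_abs, real_inner_comm, sub_zero]
    rw [← hz n, e2, e1] at hup
    have h1 : 0 ≤ (1 - θ) * (t n ^ 2 * ‖v‖ ^ 2) := mul_nonneg (by linarith) (by positivity)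
    have h2 : t n * ⟪v, z n⟫_ℝ ≤ 0 := by nlinarith
    exact nonpos_of_mul_nonpos_right h2 (ht0 n)
  have hbdd : ∀ n, z n ∈ closedBall (0 : Y) (2 * (1 + ‖v‖)) := by
    intro n
    have h1 : ‖z n - (y - t n • v)‖ ≤ ‖y - t n • v‖ := by
      rw [hz n]
      simpa only [zero_sub, norm_neg] using infDist_le_norm_sub h0 (y - t n • v)
    have h2 : ‖y - t n • v‖ ≤ 1 + ‖v‖ := by
      refine (norm_sub_le _ _).trans ?_
      rw [hy, norm_smul, Real.norm_of_nonneg (ht0 n).le]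
      have h3 : t n ≤ 1 := by
        refine (div_le_one (by positivity)).2 ?_
        have : (0 : ℝ) ≤ n := n.cast_nonneg
        linarith
      have := mul_le_mul_of_nonneg_right h3 (norm_nonneg v)
      linarith
    have h4 := norm_add_le (z n - (y - t n • v)) (y - t n • v)
    rw [sub_add_cancel] at h4
    rw [mem_closedBall_zero_iff]
    linarith
  obtain ⟨w, -, φ, hφ, hw⟩ := (isCompact_closedBall _ _).tendsto_subseq hbdd
  refine ⟨w, hCc.mem_of_tendsto hw (Eventually.of_forall fun n => hzC _), ?_, ?_⟩
  · have hyφ := hyt.comp hφ.tendsto_atTop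
    have h1 := (hw.sub hyφ).norm
    have h2 := ((continuous_infDist_pt C).tendsto y).comp hyφ
    refine tendsto_nhds_unique h1 (h2.congr fun n => ?_)
    exact (hz (φ n)).symm
  · exact le_of_tendsto ((tendsto_const_nhds (x := v)).inner hw)
      (Eventually.of_forall fun n => hzneg _)

theorem isCompact_setOf_norm_sub_eq {Y : Type} [NormedAddCommGroup Y] [ProperSpace Y] {C : Set Y}
    (hC : IsClosed C) (y : Y) (r : ℝ) : IsCompact {z | z ∈ C ∧ ‖z - y‖ = r} := by
  have h : {z | z ∈ C ∧ ‖z - y‖ = r} = sphere y r ∩ C := by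
    ext z
    simp [and_comm]
  rw [h]
  exact (isCompact_sphere y r).inter_right hC

/-- In finite dimension the convex hull of a compact set is compact. -/
theorem isCompact_convexHull_of_isCompact {Y : Type} [NormedAddCommGroup Y] [NormedSpace ℝ Y]
    [FiniteDimensional ℝ Y] {P : Set Y} (hP : IsCompact P) : IsCompact (convexHull ℝ P) := by
  let n := Module.finrank ℝ Y + 1
  have hK : IsCompact (stdSimplex ℝ (Fin n) ×ˢ Set.pi Set.univ fun _ : Fin n => P) :=
    (isCompact_stdSimplex ℝ (Fin n)).prod (isCompact_univ_pi fun _ => hP)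
  have hcont : Continuous fun q : (Fin n → ℝ) × (Fin n → Y) => ∑ i, q.1 i • q.2 i := by fun_prop
  convert hK.image hcont using 1
  apply Set.Subset.antisymm
  · intro x hx
    obtain ⟨p, hp⟩ := convexHull_nonempty_iff.1 ⟨x, hx⟩
    obtain ⟨ι, _, z, w, hz, hind, hw0, hw1, hx⟩ := eq_pos_convex_span_of_mem_convexHull hx
    obtain ⟨e⟩ : Nonempty (ι ↪ Fin n) := by
      apply Function.Embedding.nonempty_of_card_le
      rw [Fintype.card_fin]
      exact hind.card_le_finrank_succ.trans
        (Nat.add_le_add_right (Submodule.finrank_le _) 1)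
    have hwe : ∀ i, Function.extend e w 0 (e i) = w i := e.injective.extend_apply w 0
    have hze : ∀ i, Function.extend e z (fun _ => p) (e i) = z i := e.injective.extend_apply z _
    have hwo : ∀ j ∉ Set.range e, Function.extend e w 0 j = 0 := fun j hj =>
      Function.extend_apply' w (0 : Fin n → ℝ) j hj
    refine ⟨(Function.extend e w 0, Function.extend e z fun _ => p), ⟨⟨fun j => ?_, ?_⟩, ?_⟩, ?_⟩
    · by_cases hj : j ∈ Set.range e
      · obtain ⟨i, rfl⟩ := hj
        exact (hw0 i).le.trans_eq (hwe i).symm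
      · exact (hwo j hj).ge
    · rw [← hw1]
      exact (Fintype.sum_of_injective e e.injective _ _ hwo fun i => (hwe i).symm).symm
    · intro j _
      by_cases hj : j ∈ Set.range e
      · obtain ⟨i, rfl⟩ := hj
        simpa only [hze] using hz (Set.mem_range_self i)
      · simpa only [Function.extend_apply' z _ j hj] using hp
    · rw [← hx]
      refine (Fintype.sum_of_injective e e.injective _ _ (fun j hj => ?_) fun i => ?_).symm
      · simp only [hwo j hj, zero_smul]
      · simp only [hwe, hze]
  · rintro _ ⟨⟨w, z⟩, ⟨⟨hw0, hw1⟩, hz⟩, rfl⟩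
    exact (convex_convexHull ℝ P).sum_mem (fun i _ => hw0 i) hw1
      fun i _ => subset_convexHull ℝ P (hz i (Set.mem_univ i))

theorem exists_inner_lt_of_notMem_convexHull {Y : Type} [NormedAddCommGroup Y]
    [InnerProductSpace ℝ Y] [FiniteDimensional ℝ Y] {P : Set Y} (hP : IsCompact P) {c : Y}
    (hc : c ∉ convexHull ℝ P) : ∃ v : Y, ∀ z ∈ P, 0 < ⟪v, z - c⟫_ℝ := by
  have := FiniteDimensional.complete ℝ Y
  obtain ⟨f, u, hu, hf⟩ :=
    geometric_hahn_banach_point_closed (convex_convexHull ℝ P)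
      (isCompact_convexHull_of_isCompact hP).isClosed hc
  refine ⟨(InnerProductSpace.toDual ℝ Y).symm f, fun z hz => ?_⟩
  rw [InnerProductSpace.toDual_symm_apply, map_sub, sub_pos]
  exact hu.trans (hf z (subset_convexHull ℝ P hz))

theorem bestApprox_nonunique_at_worst_case {Y : Type} [NormedAddCommGroup Y]
    [InnerProductSpace ℝ Y] [FiniteDimensional ℝ Y] [Nontrivial Y] {m : ℕ}
    (D : Set (Fin m → ℝ)) (hD : D.Nonempty) (F : (Fin m → ℝ) → Y)
    (hcone : ∀ y ∈ F '' D, ∀ s : ℝ, 0 < s → s • y ∈ F '' D)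
    (hexpr : ∀ y : Y, y ≠ 0 → lossInf D F y < ‖y‖ ^ 2)
    (hcl : closure (F '' D) ≠ Set.univ) :
    0 < Theta D F ∧ Theta D F < 1 ∧
    ∀ ybar : Y, ‖ybar‖ = 1 → lossInf D F ybar = Theta D F →
      (∃ z₁ ∈ bestApprox D F ybar, ∃ z₂ ∈ bestApprox D F ybar, z₁ ≠ z₂) ∧
      (∀ z ∈ bestApprox D F ybar, ⟪ybar, z - (1 - Theta D F) • ybar⟫_ℝ = 0) ∧
      (1 - Theta D F) • ybar ∈ convexHull ℝ (bestApprox D F ybar) := by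
  have hproper : ProperSpace Y := FiniteDimensional.proper ℝ Y
  have h0 := zero_mem_closure_of_cone (hD.image F) hcone
  have hCcone : ∀ z ∈ closure (F '' D), ∀ s : ℝ, 0 < s → s • z ∈ closure (F '' D) :=
    fun z hz s hs => smul_mem_closure_of_cone hcone hz hs
  have hCc : IsClosed (closure (F '' D)) := isClosed_closure
  have hloss := lossInf_eq_infDist_sq hD F
  have hP : ∀ y, bestApprox D F y =
    {z | z ∈ closure (F '' D) ∧ ‖z - y‖ = infDist y (closure (F '' D))} := fun _ => rfl
  have hθdef : Theta D F = sSup ((fun y => lossInf D F y) '' {y : Y | ‖y‖ = 1}) := rfl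
  simp only [hloss] at hexpr hθdef ⊢
  simp only [hP]
  generalize closure (F '' D) = C at *
  generalize Theta D F = θ at *
  -- the supremum defining `θ` is an attained maximum over the unit sphere
  have hmax : ∃ u : Y, ‖u‖ = 1 ∧ infDist u C ^ 2 = θ ∧
      ∀ y : Y, ‖y‖ = 1 → infDist y C ^ 2 ≤ θ := by
    have hs : {y : Y | ‖y‖ = 1} = sphere 0 1 := by ext; simp
    have hcont : Continuous fun y : Y => infDist y C ^ 2 := (continuous_infDist_pt C).pow 2
    obtain ⟨u, hu, hg⟩ := (isCompact_sphere (0 : Y) 1).exists_isMaxOn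
      (NormedSpace.sphere_nonempty.2 zero_le_one) hcont.continuousOn
    have hG : IsGreatest ((fun y : Y => infDist y C ^ 2) '' {y : Y | ‖y‖ = 1})
        (infDist u C ^ 2) := by
      rw [hs]
      exact ⟨⟨u, hu, rfl⟩, by rintro _ ⟨y, hy, rfl⟩; exact hg hy⟩
    rw [hθdef, hG.csSup_eq]
    exact ⟨u, by simpa using hu, rfl, fun y hy => hG.2 ⟨y, hy, rfl⟩⟩
  obtain ⟨u, hu, huθ, hle⟩ := hmax
  have hθ1 : θ < 1 := by
    have := hexpr u (by rintro rfl; simp at hu)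
    rwa [huθ, hu, one_pow] at this
  have hbound : ∀ y : Y, infDist y C ^ 2 ≤ θ * ‖y‖ ^ 2 := by
    intro y
    rcases eq_or_ne y 0 with rfl | hy
    · simp [infDist_zero_of_mem h0]
    have hn : 0 < ‖y‖ := norm_pos_iff.2 hy
    have h1 := infDist_smul_le_of_cone hCc ⟨0, h0⟩ hCcone (‖y‖⁻¹ • y) hn
    rw [smul_inv_smul₀ hn.ne'] at h1
    have h2 := hle (‖y‖⁻¹ • y) (norm_smul_inv_norm (𝕜 := ℝ) hy)
    calc infDist y C ^ 2 ≤ (‖y‖ * infDist (‖y‖⁻¹ • y) C) ^ 2 :=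
          pow_le_pow_left₀ infDist_nonneg h1 2
      _ = infDist (‖y‖⁻¹ • y) C ^ 2 * ‖y‖ ^ 2 := by ring
      _ ≤ θ * ‖y‖ ^ 2 := by gcongr
  have hθ0 : 0 < θ := by
    obtain ⟨y, hy⟩ := (Set.ne_univ_iff_exists_notMem _).1 hcl
    have h1 : 0 < infDist y C := (hCc.notMem_iff_infDist_pos ⟨0, h0⟩).1 hy
    by_contra! hneg
    have h2 := hbound y
    have h3 : θ * ‖y‖ ^ 2 ≤ 0 := mul_nonpos_of_nonpos_of_nonneg hneg (by positivity)
    have : 0 < infDist y C ^ 2 := by positivity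
    linarith
  refine ⟨hθ0, hθ1, fun y hy hyθ => ?_⟩
  have horth : ∀ z ∈ {z | z ∈ C ∧ ‖z - y‖ = infDist y C}, ⟪y, z - (1 - θ) • y⟫_ℝ = 0 := by
    rintro z ⟨hzC, hz⟩
    have h1 := inner_eq_norm_sq_of_norm_sub_eq_infDist hCcone hzC hz
    have h2 : ‖z - y‖ ^ 2 = θ := by rw [hz, hyθ]
    rw [norm_sub_sq_real, hy, real_inner_comm] at h2
    rw [inner_sub_right, real_inner_smul_right, real_inner_self_eq_norm_sq, hy]
    linarith
  have hconv : (1 - θ) • y ∈ convexHull ℝ {z | z ∈ C ∧ ‖z - y‖ = infDist y C} := by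
    by_contra hc
    obtain ⟨v, hv⟩ := exists_inner_lt_of_notMem_convexHull
      (isCompact_setOf_norm_sub_eq hCc y _) hc
    have hw : ⟪y, v - ⟪y, v⟫_ℝ • y⟫_ℝ = 0 := by
      rw [inner_sub_right, real_inner_smul_right, real_inner_self_eq_norm_sq, hy]
      ring
    obtain ⟨z, hzC, hz, hneg⟩ :=
      exists_bestApprox_inner_nonpos hCc h0 hθ1 hbound hy hyθ hw
    have h1 := hv z ⟨hzC, hz⟩
    have h2 : ⟪v - ⟪y, v⟫_ℝ • y, z - (1 - θ) • y⟫_ℝ = ⟪v, z - (1 - θ) • y⟫_ℝ := by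
      rw [inner_sub_left, real_inner_smul_left, horth z ⟨hzC, hz⟩]
      ring
    rw [← h2, inner_sub_right, real_inner_smul_right, real_inner_comm, real_inner_comm y, hw] at h1
    rw [real_inner_comm] at hneg
    linarith
  refine ⟨?_, horth, hconv⟩
  by_contra! hsub
  obtain ⟨z, hz⟩ := convexHull_nonempty_iff.1 ⟨_, hconv⟩
  have hmem : (1 - θ) • y ∈ ({z} : Set Y) :=
    convexHull_min (fun w hw => hsub w hw z hz) (convex_singleton z) hconv
  have hyC : y ∈ C := by
    have h1 : 0 < 1 - θ := by linarith
    have h2 := hCcone z hz.1 (1 - θ)⁻¹ (inv_pos.2 h1)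
    rwa [← Set.mem_singleton_iff.1 hmem, inv_smul_smul₀ h1.ne'] at h2
  rw [infDist_zero_of_mem hyC] at hyθ
  linarith
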